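/- Let I be a monomial ideal in a polynomial ring S. If I is Buchsbaum, then the radical √I of I is Buchsbaum. -/

import Mathlib

open CategoryTheory CategoryTheory.Limits MvPolynomial

noncomputable section

namespace SkewTab

/-! ### Partitions and skew shapes (0-indexed) -/

/-- `lam` is a partition with exactly `n` positive parts (0-indexed),
extended by `0` beyond index `n - 1`. -/
def IsPartitionFn (n : ℕ) (lam : ℕ → ℕ) : Prop :=
  0 < n ∧ Antitone lam ∧ (∀ i, i < n → 0 < lam i) ∧ ∀ i, n ≤ i → lam i = 0

/-- `λ/μ` is a skew shape with `n` rows (0-indexed): `λ_i > μ_i ≥ 0` and `μ_n = 0`. -/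
def IsSkewShape (n : ℕ) (lam mu : ℕ → ℕ) : Prop :=
  0 < n ∧ Antitone lam ∧ Antitone mu ∧ (∀ i, i < n → mu i < lam i) ∧
    (∀ i, n ≤ i → lam i = 0) ∧ mu (n - 1) = 0

/-- The conjugate partition: `conj lam j = #{i : lam i > j}` (0-indexed). -/
def conj (lam : ℕ → ℕ) (j : ℕ) : ℕ := Nat.card {i | j < lam i}

/-- The set of boxes of the skew diagram `λ/μ` (0-indexed `(row, column)` pairs). -/
def skewDiagram (lam mu : ℕ → ℕ) : Set (ℕ × ℕ) :=
  {p | mu p.1 ≤ p.2 ∧ p.2 < lam p.1}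

/-- The set of boxes of the Ferrers diagram of a partition. -/
def ferrers (nu : ℕ → ℕ) : Set (ℕ × ℕ) := {p | p.2 < nu p.1}

/-- The block of the Ferrers diagram of `nu` containing the box `p`:  blocks are the
rectangular regions cut out by the horizontal lines at the values of the conjugate
partition and the vertical lines at the values of the partition. -/
def blockOf (nu : ℕ → ℕ) (p : ℕ × ℕ) : Set (ℕ × ℕ) :=
  {q | q.2 < nu q.1 ∧ nu q.1 = nu p.1 ∧ conj nu q.2 = conj nu p.2}

/-- A box `(i,j)` of the diagram of `nu` lies in a *corner block* iff its block has no
block to its right nor below it. -/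
def InCornerBlock (nu : ℕ → ℕ) (i j : ℕ) : Prop :=
  j < nu i ∧ conj nu (nu i - 1) = conj nu j ∧ nu (conj nu j - 1) = nu i

/-- A partition is unmixed iff all its corner blocks are square
(height of the block = width of the block). -/
def IsUnmixedPartition (nu : ℕ → ℕ) : Prop :=
  (∃ n, IsPartitionFn n nu) ∧
    ∀ i j, InCornerBlock nu i j →
      conj nu (nu i - 1) - conj nu (nu i) = nu (conj nu j - 1) - nu (conj nu j)

/-- A partition all of whose corner blocks are single boxes (1 × 1):
the condition defining prime Cohen-Macaulay shapes. -/
def IsCMPartition (nu : ℕ → ℕ) : Prop :=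
  (∃ n, IsPartitionFn n nu) ∧
    ∀ i j, InCornerBlock nu i j →
      conj nu (nu i - 1) - conj nu (nu i) = 1 ∧ nu (conj nu j - 1) - nu (conj nu j) = 1

/-- A copy of (the diagram of) a partition `nu` placed in the plane.  If `upper = true`
it is placed rotated by 180° and anchored at the bottom-right position `(row, col)`
(an upper triangular shape, hugging the top-right); if `upper = false` it is placed as is,
translated by `(row, col)` (a lower triangular shape, hugging the bottom-left). -/
structure PlacedShape where
  nu : ℕ → ℕ
  row : ℕ
  col : ℕ
  upper : Bool

/-- The embedding of the abstract diagram of `B.nu` into the plane. -/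
def PlacedShape.emb (B : PlacedShape) : ℕ × ℕ → ℕ × ℕ := fun p =>
  if B.upper then (B.row - p.1, B.col - p.2) else (B.row + p.1, B.col + p.2)

/-- The set of boxes of a placed shape. -/
def PlacedShape.boxes (B : PlacedShape) : Set (ℕ × ℕ) := B.emb '' ferrers B.nu

/-- For an upper triangular placed shape the anchor must leave room for the whole
(rotated) diagram. -/
def PlacedShape.Valid (B : PlacedShape) : Prop :=
  B.upper = true → conj B.nu 0 ≤ B.row + 1 ∧ B.nu 0 ≤ B.col + 1

/-- The two extremal blocks (top-right and bottom-left corner blocks) of a placed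
shape, as subsets of the plane. -/
def PlacedShape.extremalBlocks (B : PlacedShape) : Set (Set (ℕ × ℕ)) :=
  {B.emb '' blockOf B.nu (0, B.nu 0 - 1), B.emb '' blockOf B.nu (conj B.nu 0 - 1, 0)}

/-- `D` decomposes as a union of prime shapes `B 0, …, B (t-1)` (each a placed copy of a
partition satisfying `P`), consecutive shapes being of alternating (upper/lower) type and
intersecting exactly in a common extremal block. -/
def IsPrimeDecomposition (P : (ℕ → ℕ) → Prop) (D : Set (ℕ × ℕ)) (t : ℕ)
    (B : ℕ → PlacedShape) : Prop :=
  0 < t ∧ (∀ k, k < t → P (B k).nu ∧ (B k).Valid) ∧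
    (⋃ k ∈ Set.Iio t, (B k).boxes) = D ∧
    (∀ k, k + 1 < t → (B k).upper ≠ (B (k + 1)).upper) ∧
    ∀ k, k + 1 < t →
      (B k).boxes ∩ (B (k + 1)).boxes ∈ (B k).extremalBlocks ∧
      (B k).boxes ∩ (B (k + 1)).boxes ∈ (B (k + 1)).extremalBlocks

/-- The filling `w` is weakly increasing along both rows and columns on the boxes of `S`. -/
def WeaklyIncreasingOn (w : ℕ → ℕ → ℕ) (S : Set (ℕ × ℕ)) : Prop :=
  (∀ i j, (i, j) ∈ S → (i, j + 1) ∈ S → w i j ≤ w i (j + 1)) ∧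
    ∀ i j, (i, j) ∈ S → (i + 1, j) ∈ S → w i j ≤ w (i + 1) j

/-- The filling `w` is weakly decreasing along both rows and columns on the boxes of `S`. -/
def WeaklyDecreasingOn (w : ℕ → ℕ → ℕ) (S : Set (ℕ × ℕ)) : Prop :=
  (∀ i j, (i, j) ∈ S → (i, j + 1) ∈ S → w i (j + 1) ≤ w i j) ∧
    ∀ i j, (i, j) ∈ S → (i + 1, j) ∈ S → w (i + 1) j ≤ w i j

/-! ### Ideals and graphs attached to skew shapes -/

/-- The skew Ferrers ideal `I_{λ/μ}` in `k[x_1,…,x_n,y_1,…,y_m]`, `m = λ_1`. -/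
def skewIdeal (k : Type) [Field k] (n : ℕ) (lam mu : ℕ → ℕ) :
    Ideal (MvPolynomial (Fin n ⊕ Fin (lam 0)) k) :=
  Ideal.span {q | ∃ (i : Fin n) (j : Fin (lam 0)),
    mu (i : ℕ) ≤ (j : ℕ) ∧ (j : ℕ) < lam (i : ℕ) ∧ q = X (Sum.inl i) * X (Sum.inr j)}

/-- The skew tableau ideal `I(Y)` of the filling `w` of the skew shape `λ/μ`. -/
def tableauIdeal (k : Type) [Field k] (n : ℕ) (lam mu : ℕ → ℕ) (w : ℕ → ℕ → ℕ) :
    Ideal (MvPolynomial (Fin n ⊕ Fin (lam 0)) k) :=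
  Ideal.span {q | ∃ (i : Fin n) (j : Fin (lam 0)),
    mu (i : ℕ) ≤ (j : ℕ) ∧ (j : ℕ) < lam (i : ℕ) ∧
      q = (X (Sum.inl i) * X (Sum.inr j)) ^ w (i : ℕ) (j : ℕ)}

/-- The skew tableau ideal of the skew tableau obtained from `Y` by keeping only the rows
in `Rs` and the columns in `Cs`. -/
def tableauIdealRC (k : Type) [Field k] (n m : ℕ) (lam mu : ℕ → ℕ) (w : ℕ → ℕ → ℕ)
    (Rs : Set (Fin n)) (Cs : Set (Fin m)) : Ideal (MvPolynomial (↥Rs ⊕ ↥Cs) k) :=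
  Ideal.span {q | ∃ (i : ↥Rs) (j : ↥Cs),
    mu (i.1 : ℕ) ≤ (j.1 : ℕ) ∧ (j.1 : ℕ) < lam (i.1 : ℕ) ∧
      q = (X (Sum.inl i) * X (Sum.inr j)) ^ w (i.1 : ℕ) (j.1 : ℕ)}

/-- The skew Ferrers graph `G_{λ/μ}`, a bipartite graph on `{x_1,…,x_n} ⊔ {y_1,…,y_m}`. -/
def skewGraph (n : ℕ) (lam mu : ℕ → ℕ) : SimpleGraph (Fin n ⊕ Fin (lam 0)) :=
  SimpleGraph.fromRel fun a b => ∃ (i : Fin n) (j : Fin (lam 0)),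
    mu (i : ℕ) ≤ (j : ℕ) ∧ (j : ℕ) < lam (i : ℕ) ∧ a = Sum.inl i ∧ b = Sum.inr j

/-- The edge ideal of a simple graph. -/
def edgeIdeal (k : Type) [Field k] {V : Type} (G : SimpleGraph V) :
    Ideal (MvPolynomial V k) :=
  Ideal.span {q | ∃ u v, G.Adj u v ∧ q = X u * X v}

/-- The edge ideal of an edge-weighted simple graph. -/
def edgeIdealW (k : Type) [Field k] {V : Type} (G : SimpleGraph V) (w : V → V → ℕ) :
    Ideal (MvPolynomial V k) :=
  Ideal.span {q | ∃ u v, G.Adj u v ∧ q = (X u * X v) ^ w u v}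

/-! ### Homological notions -/

/-- The homogeneous maximal ideal of a polynomial ring. -/
def maxIdeal (k : Type) [Field k] (σ : Type) : Ideal (MvPolynomial σ k) :=
  Ideal.span (Set.range (X : σ → MvPolynomial σ k))

/-- The `i`-th local cohomology of the `R`-module `M` supported at the ideal `J`. -/
def localCoh {R : Type} [CommRing R] (J : Ideal R) (i : ℕ) (M : Type) [AddCommGroup M]
    [Module R M] : ModuleCat R :=
  (localCohomology J i).obj (ModuleCat.of R M)

/-- The Krull dimension of a module, `dim (R / ann M)`. -/
def moduleDim (R : Type) [CommRing R] (M : Type) [AddCommGroup M] [Module R M] :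
    WithBot ℕ∞ :=
  ringKrullDim (R ⧸ Module.annihilator R M)

/-- A module `M` is Cohen-Macaulay (w.r.t. the maximal ideal `J`) if
`H^i_J(M) = 0` for all `i < dim M`. -/
def IsCMModule {R : Type} [CommRing R] (J : Ideal R) (M : Type) [AddCommGroup M]
    [Module R M] : Prop :=
  ∀ i : ℕ, (i : WithBot ℕ∞) < moduleDim R M → IsZero (localCoh J i M)

/-- An ideal `I` is Cohen-Macaulay if `H^i_J(R/I) = 0` for all `i < dim R/I`
(`J` the maximal ideal). -/
def IsCMIdeal {R : Type} [CommRing R] (J I : Ideal R) : Prop :=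
  ∀ i : ℕ, (i : WithBot ℕ∞) < ringKrullDim (R ⧸ I) → IsZero (localCoh J i (R ⧸ I))

/-- An ideal `I` is generalized Cohen-Macaulay if `H^i_J(R/I)` has finite length for
all `i < dim R/I`. -/
def IsGCMIdeal {R : Type} [CommRing R] (J I : Ideal R) : Prop :=
  ∀ i : ℕ, (i : WithBot ℕ∞) < ringKrullDim (R ⧸ I) → IsFiniteLength R (localCoh J i (R ⧸ I))

/-- The canonical map `Ext^i(R/J, M) → H^i_J(M)`, i.e. the structure map of the colimit
defining local cohomology, at the first power of `J`. -/
def extToLocalCoh {R : Type} [CommRing R] (J : Ideal R) (i : ℕ) (M : ModuleCat R) :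
    ((localCohomology.diagram (localCohomology.idealPowersDiagram J) i).obj
        (Opposite.op (Opposite.op (1 : ℕ)))).obj M ⟶ (localCohomology J i).obj M :=
  have := localCohomology.hasColimitDiagram (localCohomology.idealPowersDiagram J) i
  (colimit.ι (localCohomology.diagram (localCohomology.idealPowersDiagram J) i)
    (Opposite.op (Opposite.op (1 : ℕ)))).app M

/-- An ideal `I` is Buchsbaum if the canonical map `Ext^i(R/J, R/I) → H^i_J(R/I)` is
surjective for all `i < dim R/I` (`J` the maximal ideal). -/
def IsBuchsbaumIdeal {R : Type} [CommRing R] (J I : Ideal R) : Prop :=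
  ∀ i : ℕ, (i : WithBot ℕ∞) < ringKrullDim (R ⧸ I) →
    Function.Surjective (extToLocalCoh J i (ModuleCat.of R (R ⧸ I)))

/-- An ideal `I` is unmixed if `dim R/P = dim R/I` for all associated primes `P` of `R/I`. -/
def IsUnmixedIdeal {R : Type} [CommRing R] (I : Ideal R) : Prop :=
  ∀ P ∈ associatedPrimes R (R ⧸ I), ringKrullDim (R ⧸ P) = ringKrullDim (R ⧸ I)

/-- A submodule of `S/J` (`S` a polynomial ring) is graded if it is the image of a
homogeneous ideal of `S`. -/
def IsGradedSubmodule (k σ : Type) [Field k] (J : Ideal (MvPolynomial σ k))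
    (N : Submodule (MvPolynomial σ k) (MvPolynomial σ k ⧸ J)) : Prop :=
  letI := MvPolynomial.gradedAlgebra (σ := σ) (R := k)
  ∃ K : Ideal (MvPolynomial σ k), Ideal.IsHomogeneous (homogeneousSubmodule σ k) K ∧
    ∀ x, x ∈ N ↔ x ∈ K.map (Ideal.Quotient.mk J)

/-- A (homogeneous) ideal `J` of a polynomial ring `S` is sequentially Cohen-Macaulay if
`S/J` admits a filtration `0 = M_0 ⊂ M_1 ⊂ ⋯ ⊂ M_r = S/J` by graded submodules such that
every quotient `M_{i+1}/M_i` is Cohen-Macaulay and the dimensions of the quotients are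
strictly increasing. -/
def IsSCMIdeal (k σ : Type) [Field k] (J : Ideal (MvPolynomial σ k)) : Prop :=
  ∃ (r : ℕ) (M : ℕ → Submodule (MvPolynomial σ k) (MvPolynomial σ k ⧸ J)),
    M 0 = ⊥ ∧ M r = ⊤ ∧ (∀ i, i < r → M i < M (i + 1)) ∧
    (∀ i, i ≤ r → IsGradedSubmodule k σ J (M i)) ∧
    (∀ i, i < r → IsCMModule (maxIdeal k σ)
      (↥(M (i + 1)) ⧸ Submodule.comap (M (i + 1)).subtype (M i))) ∧
    ∀ i, i + 2 ≤ r →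
      moduleDim (MvPolynomial σ k)
          (↥(M (i + 1)) ⧸ Submodule.comap (M (i + 1)).subtype (M i)) <
        moduleDim (MvPolynomial σ k)
          (↥(M (i + 2)) ⧸ Submodule.comap (M (i + 2)).subtype (M (i + 1)))

/-- A graph is sequentially Cohen-Macaulay if its edge ideal is. -/
def IsSCMGraph (k : Type) [Field k] {V : Type} (G : SimpleGraph V) : Prop :=
  IsSCMIdeal k V (edgeIdeal k G)

/-! ### Monomial ideals -/

/-- A monomial of a polynomial ring. -/
def IsMonomial {k σ : Type} [Field k] (u : MvPolynomial σ k) : Prop :=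
  ∃ d : σ →₀ ℕ, u = monomial d 1

/-- A monomial ideal of a polynomial ring. -/
def IsMonomialIdeal {k σ : Type} [Field k] (I : Ideal (MvPolynomial σ k)) : Prop :=
  ∃ T : Set (σ →₀ ℕ), I = Ideal.span ((fun d => (monomial d (1 : k) : MvPolynomial σ k)) '' T)

/-! ### Saturated partitions -/

/-- A partition is saturated if it is either strictly decreasing, or
`{λ_i, λ_i - 1, …, 1} ⊆ {λ_1, …, λ_n}` where `i` is the smallest index with
`λ_i = λ_{i+1}` (0-indexed here). -/
def IsSaturated (n : ℕ) (lam : ℕ → ℕ) : Prop :=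
  StrictAntiOn lam (Set.Iio n) ∨
    ∃ i, i + 1 < n ∧ lam i = lam (i + 1) ∧ (∀ j, j < i → lam j ≠ lam (j + 1)) ∧
      ∀ v, 0 < v → v ≤ lam i → ∃ a, a < n ∧ lam a = v

/-! ### Vertex decomposability -/

/-- A set `T` of vertices is independent in `G`. -/
def IsIndepSet {V : Type} (G : SimpleGraph V) (T : Finset V) : Prop :=
  ∀ u ∈ T, ∀ v ∈ T, ¬G.Adj u v

open Classical in
/-- The induced subgraph of `G` on a finite vertex set `A` is vertex decomposable:
either it has no edges, or it has a shredding vertex `v`, i.e. a vertex such that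
`G \ v` and `G \ N[v]` are vertex decomposable and no independent set of `G \ N[v]`
is a maximal independent set of `G \ v`. -/
def IsVertexDecomposable {V : Type} (G : SimpleGraph V) : Finset V → Prop := fun A =>
  (∀ u ∈ A, ∀ v ∈ A, ¬G.Adj u v) ∨
    ∃ v, ∃ _ : v ∈ A,
      IsVertexDecomposable G (A.erase v) ∧
      IsVertexDecomposable G (A.filter fun u => u ≠ v ∧ ¬G.Adj v u) ∧
      ∀ T ⊆ A.filter fun u => u ≠ v ∧ ¬G.Adj v u, IsIndepSet G T →
        ¬(T ⊆ A.erase v ∧ IsIndepSet G T ∧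
            ∀ u ∈ A.erase v, u ∉ T → ∃ t ∈ T, G.Adj u t)
termination_by A => A.card
decreasing_by
  · exact Finset.card_erase_lt_of_mem ‹_›
  · exact Finset.card_lt_card (Finset.filter_ssubset.mpr ⟨v, ‹_›, by simp⟩)

section LeftDerived

universe v₁ v₂ v₃ u₁ u₂ u₃
variable {C : Type u₁} [Category.{v₁} C] [Abelian C] [HasProjectiveResolutions C]
  {D : Type u₂} [Category.{v₂} D] [Abelian D] [HasProjectiveResolutions D]
  {E : Type u₃} [Category.{v₃} E] [Abelian E]

/-- Left derived functors of a composite whose first factor is exact and preserves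
projectives. -/
def leftDerivedPrecompIso (F : C ⥤ D) [F.Additive] [F.PreservesProjectiveObjects]
    [F.PreservesHomology] (G : D ⥤ E) [G.Additive] (n : ℕ) :
    (F ⋙ G).leftDerived n ≅ F ⋙ G.leftDerived n :=
  NatIso.ofComponents
    (fun X => (projectiveResolution X).isoLeftDerivedObj (F ⋙ G) n ≪≫
      ((F.mapProjectiveResolution (projectiveResolution X)).isoLeftDerivedObj G n).symm)
    (fun {X Y} f => by
      have h1 := ProjectiveResolution.isoLeftDerivedObj_hom_naturality f (projectiveResolution X)
        (projectiveResolution Y) (ProjectiveResolution.lift f _ _)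
        (ProjectiveResolution.lift_commutes_zero f _ _) (F ⋙ G) n
      have h2 := ProjectiveResolution.isoLeftDerivedObj_inv_naturality (F.map f)
        (F.mapProjectiveResolution (projectiveResolution X))
        (F.mapProjectiveResolution (projectiveResolution Y))
        ((F.mapHomologicalComplex _).map (ProjectiveResolution.lift f _ _)) (by
          have h0 := congr_arg F.map (ProjectiveResolution.lift_commutes_zero f
            (projectiveResolution X) (projectiveResolution Y))
          rw [F.map_comp] at h0
          have h0' := h0.trans (F.map_comp _ f)
          simp only [Functor.mapHomologicalComplex_map_f, Functor.mapProjectiveResolution_π,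
            HomologicalComplex.comp_f, HomologicalComplex.singleMapHomologicalComplex_hom_app_self]
          erw [Category.comp_id, Category.comp_id]
          change _ ≫ _ ≫ F.map (𝟙 _) = (_ ≫ F.map (𝟙 _)) ≫ _
          erw [F.map_id, F.map_id, Category.comp_id, Category.comp_id]
          exact h0') G n
      exact (CommSq.vert_comp ⟨h1⟩ ⟨h2.symm⟩).w)

/-- Left derived functors of a composite whose second factor is exact. -/
def leftDerivedPostcompIso (G : C ⥤ D) [G.Additive] (F : D ⥤ E) [F.Additive]
    [F.PreservesHomology] (n : ℕ) :
    (G ⋙ F).leftDerived n ≅ G.leftDerived n ⋙ F :=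
  NatIso.ofComponents
    (fun X => (projectiveResolution X).isoLeftDerivedObj (G ⋙ F) n ≪≫
      ShortComplex.mapHomologyIso
        (((G.mapHomologicalComplex _).obj (projectiveResolution X).complex).sc n) F ≪≫
      F.mapIso ((projectiveResolution X).isoLeftDerivedObj G n).symm)
    (fun {X Y} f => by
      have h := ProjectiveResolution.lift_commutes_zero f (projectiveResolution X)
        (projectiveResolution Y)
      have h1 := ProjectiveResolution.isoLeftDerivedObj_hom_naturality f (projectiveResolution X)
        (projectiveResolution Y) (ProjectiveResolution.lift f _ _) h (G ⋙ F) n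
      have h2 := congr_arg F.map (ProjectiveResolution.isoLeftDerivedObj_inv_naturality f
        (projectiveResolution X) (projectiveResolution Y) (ProjectiveResolution.lift f _ _) h G n)
      rw [F.map_comp, F.map_comp] at h2
      have h3 := ShortComplex.mapHomologyIso_hom_naturality
        ((HomologicalComplex.shortComplexFunctor _ _ n).map
          ((G.mapHomologicalComplex _).map (ProjectiveResolution.lift f (projectiveResolution X)
        (projectiveResolution Y)))) F
      exact (CommSq.vert_comp ⟨h1⟩ (CommSq.vert_comp ⟨h3⟩ ⟨h2.symm⟩)).w)

end LeftDerived

section ExtBaseChange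

variable {R S : Type} [CommRing R] [CommRing S] (φ : R →+* S)

lemma preservesHomology_extendScalars (hφ : φ.Flat) :
    (ModuleCat.extendScalars.{0,0,0} φ).PreservesHomology := by
  have := ModuleCat.preservesFiniteLimits_extendScalars_of_flat hφ
  infer_instance

open Opposite

/-- The adjunction between extension and restriction of scalars, as a linear equivalence. -/
def homRestrictScalarsEquiv (A : ModuleCat.{0} R) (M : ModuleCat.{0} S) :
    (ModuleCat.restrictScalars φ).obj (ModuleCat.of S ((ModuleCat.extendScalars φ).obj A ⟶ M)) ≃ₗ[R]
      (A ⟶ (ModuleCat.restrictScalars φ).obj M) :=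
  { (ModuleCat.extendRestrictScalarsAdj φ).homEquiv A M with
    map_add' := fun x y => by
      ext a
      rfl
    map_smul' := fun r x => by
      ext a
      exact (ModuleCat.extendRestrictScalarsAdj_homEquiv_apply (φ r • x) a).trans rfl }

/-- `Hom(-, φ_* M)` is the composite of base change along `φ` with `Hom(-, M)`. -/
def linearYonedaRestrictScalarsIso (M : ModuleCat.{0} S) :
    ((linearYoneda R (ModuleCat.{0} R)).obj ((ModuleCat.restrictScalars φ).obj M)).rightOp ≅
      ModuleCat.extendScalars φ ⋙ (((linearYoneda S (ModuleCat.{0} S)).obj M).rightOp ⋙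
        (ModuleCat.restrictScalars φ).op) :=
  NatIso.ofComponents (fun A => Iso.op (homRestrictScalarsEquiv φ A M).toModuleIso)
    (fun {A B} f => by
      apply Quiver.Hom.unop_inj
      ext x
      exact (ModuleCat.extendRestrictScalarsAdj φ).homEquiv_naturality_left f x)

/-- Flat base change for Ext: `Ext^n(A, φ_* M) ≃ Ext^n(φ^* A, M)`, naturally in `A`. -/
lemma exists_extEquiv (hφ : φ.Flat) (M : ModuleCat.{0} S) (n : ℕ) :
    ∃ e : ∀ A : ModuleCat.{0} R,
      ((Ext R (ModuleCat.{0} R) n).obj (op A)).obj ((ModuleCat.restrictScalars φ).obj M) ≃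
      ((Ext S (ModuleCat.{0} S) n).obj (op ((ModuleCat.extendScalars φ).obj A))).obj M,
      ∀ (A B : ModuleCat.{0} R) (f : A ⟶ B) x,
        e A (((Ext R (ModuleCat.{0} R) n).map f.op).app _ x) =
          ((Ext S (ModuleCat.{0} S) n).map ((ModuleCat.extendScalars φ).map f).op).app M (e B x) := by
  have h1 : (ModuleCat.extendScalars.{0,0,0} φ).Additive :=
    (ModuleCat.extendRestrictScalarsAdj φ).left_adjoint_additive
  have h2 := preservesHomology_extendScalars φ hφ
  have h3 : (ModuleCat.extendScalars.{0,0,0} φ).PreservesProjectiveObjects :=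
    Functor.preservesProjectiveObjects_of_adjunction_of_preservesEpimorphisms
      (ModuleCat.extendRestrictScalarsAdj φ)
  let α := linearYonedaRestrictScalarsIso φ M
  let i : ((linearYoneda R (ModuleCat.{0} R)).obj
      ((ModuleCat.restrictScalars φ).obj M)).rightOp.leftDerived n ≅
      ModuleCat.extendScalars φ ⋙ (((linearYoneda S (ModuleCat.{0} S)).obj M).rightOp.leftDerived n
        ⋙ (ModuleCat.restrictScalars φ).op) :=
    { hom := NatTrans.leftDerived α.hom n
      inv := NatTrans.leftDerived α.inv n
      hom_inv_id := by rw [← NatTrans.leftDerived_comp, α.hom_inv_id, NatTrans.leftDerived_id]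
      inv_hom_id := by
        rw [← NatTrans.leftDerived_comp, α.inv_hom_id, NatTrans.leftDerived_id] } ≪≫
    leftDerivedPrecompIso _ _ n ≪≫ Functor.isoWhiskerLeft _ (leftDerivedPostcompIso _ _ n)
  refine ⟨fun A => ((i.app A).unop.toLinearEquiv.toEquiv).symm, fun A B f x => ?_⟩
  have h := congr_arg Quiver.Hom.unop (i.inv.naturality f)
  exact (ConcreteCategory.congr_hom h x).symm

end ExtBaseChange

section LocalCohomology
open Opposite

variable {R : Type} [CommRing R] (J : Ideal R) (n : ℕ)

/-- The quotient `R ⧸ J ^ r`, as an object of the diagram defining local cohomology. -/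
abbrev powQuot (r : ℕ) : ModuleCat.{0} R :=
  (localCohomology.ringModIdeals (localCohomology.idealPowersDiagram J)).obj (op r)

/-- The projection `R ⧸ J ^ s → R ⧸ J ^ r` for `r ≤ s`. -/
abbrev powQuotMap {r s : ℕ} (h : r ≤ s) : powQuot J s ⟶ powQuot J r :=
  (localCohomology.ringModIdeals (localCohomology.idealPowersDiagram J)).map (homOfLE h).op

/-- The canonical map from `Ext^n(R ⧸ J ^ r, M)` to local cohomology. -/
def powExtToLocalCoh (r : ℕ) (M : ModuleCat.{0} R) :
    ((Ext R (ModuleCat.{0} R) n).obj (op (powQuot J r))).obj M ⟶ (localCohomology J n).obj M :=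
  have := localCohomology.hasColimitDiagram (localCohomology.idealPowersDiagram J) n
  (colimit.ι (localCohomology.diagram (localCohomology.idealPowersDiagram J) n)
    (op (op r))).app M

lemma exists_powExtToLocalCoh_eq (M : ModuleCat.{0} R) (x : (localCohomology J n).obj M) :
    ∃ r ξ, powExtToLocalCoh J n r M ξ = x := by
  have := localCohomology.hasColimitDiagram (localCohomology.idealPowersDiagram J) n
  obtain ⟨r, ξ, h⟩ := Concrete.isColimit_exists_rep _
    (isColimitOfPreserves ((evaluation (ModuleCat.{0} R) (ModuleCat.{0} R)).obj M)
      (colimit.isColimit (localCohomology.diagram (localCohomology.idealPowersDiagram J) n))) x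
  exact ⟨r.unop.unop, ξ, h⟩

lemma powExtToLocalCoh_map {r s : ℕ} (h : r ≤ s) (M : ModuleCat.{0} R)
    (ξ : ((Ext R (ModuleCat.{0} R) n).obj (op (powQuot J r))).obj M) :
    powExtToLocalCoh J n s M (((Ext R (ModuleCat.{0} R) n).map (powQuotMap J h).op).app M ξ) =
      powExtToLocalCoh J n r M ξ := by
  have := localCohomology.hasColimitDiagram (localCohomology.idealPowersDiagram J) n
  have h := congr_app (colimit.w (localCohomology.diagram
    (localCohomology.idealPowersDiagram J) n) (homOfLE h).op.op) M
  exact ConcreteCategory.congr_hom h ξ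

lemma exists_map_eq_of_powExtToLocalCoh_eq {r s : ℕ} (M : ModuleCat.{0} R)
    (ξ : ((Ext R (ModuleCat.{0} R) n).obj (op (powQuot J r))).obj M)
    (η : ((Ext R (ModuleCat.{0} R) n).obj (op (powQuot J s))).obj M)
    (h : powExtToLocalCoh J n r M ξ = powExtToLocalCoh J n s M η) :
    ∃ (t : ℕ) (hr : r ≤ t) (hs : s ≤ t),
      ((Ext R (ModuleCat.{0} R) n).map (powQuotMap J hr).op).app M ξ =
        ((Ext R (ModuleCat.{0} R) n).map (powQuotMap J hs).op).app M η := by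
  have := localCohomology.hasColimitDiagram (localCohomology.idealPowersDiagram J) n
  obtain ⟨t, f, g, h⟩ := Concrete.isColimit_exists_of_rep_eq _
    (isColimitOfPreserves ((evaluation (ModuleCat.{0} R) (ModuleCat.{0} R)).obj M)
      (colimit.isColimit (localCohomology.diagram (localCohomology.idealPowersDiagram J) n)))
      (i := op (op r)) (j := op (op s)) ξ η h
  exact ⟨t.unop.unop, leOfHom f.unop.unop, leOfHom g.unop.unop, h⟩

lemma powExtToLocalCoh_naturality (r : ℕ) {M N : ModuleCat.{0} R} (f : M ⟶ N)
    (ξ : ((Ext R (ModuleCat.{0} R) n).obj (op (powQuot J r))).obj M) :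
    powExtToLocalCoh J n r N (((Ext R (ModuleCat.{0} R) n).obj (op (powQuot J r))).map f ξ) =
      (localCohomology J n).map f (powExtToLocalCoh J n r M ξ) := by
  have := localCohomology.hasColimitDiagram (localCohomology.idealPowersDiagram J) n
  exact ConcreteCategory.congr_hom ((colimit.ι (localCohomology.diagram
    (localCohomology.idealPowersDiagram J) n) (op (op r))).naturality f) ξ

/-- Surjectivity of the canonical map from Ext to local cohomology passes to retracts. -/
lemma extToLocalCoh_surjective_of_retract {M N : ModuleCat.{0} R} (ι : M ⟶ N) (ρ : N ⟶ M)
    (h : ι ≫ ρ = 𝟙 M) (hN : Function.Surjective (extToLocalCoh J n N)) :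
    Function.Surjective (extToLocalCoh J n M) := by
  intro x
  obtain ⟨ξ, hξ⟩ := hN ((localCohomology J n).map ι x)
  refine ⟨((Ext R (ModuleCat.{0} R) n).obj (op (powQuot J 1))).map ρ ξ, ?_⟩
  refine (powExtToLocalCoh_naturality J n 1 ρ ξ).trans ?_
  change (localCohomology J n).map ρ (extToLocalCoh J n N ξ) = x
  rw [hξ, ← ConcreteCategory.comp_apply, ← Functor.map_comp, h, CategoryTheory.Functor.map_id]
  rfl

lemma powQuot_hom_ext {r : ℕ} {M : ModuleCat.{0} R} {f g : powQuot J r ⟶ M}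
    (h : f (Ideal.Quotient.mk (J ^ r) 1) = g (Ideal.Quotient.mk (J ^ r) 1)) : f = g := by
  ext : 1
  apply Submodule.linearMap_qext
  exact LinearMap.ext_ring h

lemma exists_powQuot_hom {r : ℕ} {M : ModuleCat.{0} R} (x : M) (h : ∀ y ∈ J ^ r, y • x = 0) :
    ∃ u : powQuot J r ⟶ M, u (Ideal.Quotient.mk (J ^ r) 1) = x :=
  ⟨ModuleCat.ofHom (Submodule.liftQ (J ^ r) (LinearMap.toSpanSingleton R M x)
    fun y hy => h y hy), one_smul R x⟩

variable {S : Type} [CommRing S] (φ : R →+* S) {K : Ideal S}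

/-- The class of `1` as an element of the base change of `R ⧸ J ^ r`. -/
def extendPowQuotOne (r : ℕ) : (ModuleCat.extendScalars φ).obj (powQuot J r) :=
  (ModuleCat.extendRestrictScalarsAdj φ).unit.app (powQuot J r) (Ideal.Quotient.mk (J ^ r) 1)

lemma extendScalars_map_extendPowQuotOne {r s : ℕ} (h : r ≤ s) :
    (ModuleCat.extendScalars φ).map (powQuotMap J h) (extendPowQuotOne J φ s) =
      extendPowQuotOne J φ r :=
  (ConcreteCategory.congr_hom ((ModuleCat.extendRestrictScalarsAdj φ).unit.naturality
    (powQuotMap J h)) (Ideal.Quotient.mk (J ^ s) 1)).symm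

lemma exists_powQuot_hom_extendScalars {r s : ℕ} (h : K ^ s ≤ (J ^ r).map φ) :
    ∃ u : powQuot K s ⟶ (ModuleCat.extendScalars φ).obj (powQuot J r),
      u (Ideal.Quotient.mk (K ^ s) 1) = extendPowQuotOne J φ r := by
  apply exists_powQuot_hom
  suffices h' : (J ^ r).map φ ≤
      LinearMap.ker (LinearMap.toSpanSingleton S _ (extendPowQuotOne J φ r)) from
    fun y hy => h' (h hy)
  refine Ideal.map_le_iff_le_comap.mpr fun y hy => ?_
  have h1 := ((ModuleCat.extendRestrictScalarsAdj φ).unit.app (powQuot J r)).hom.map_smul y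
    (Ideal.Quotient.mk (J ^ r) 1)
  refine Eq.trans h1.symm ?_
  have h2 : y • (Ideal.Quotient.mk (J ^ r) 1 : powQuot J r) = 0 := by
    change Ideal.Quotient.mk (J ^ r) (y * 1) = 0
    rw [mul_one]
    exact Ideal.Quotient.eq_zero_iff_mem.mpr hy
  exact (congr_arg _ h2).trans (map_zero _)

lemma exists_extendScalars_hom_powQuot (r : ℕ) (h : J.map φ ≤ K) :
    ∃ v : (ModuleCat.extendScalars φ).obj (powQuot J r) ⟶ powQuot K r,
      v (extendPowQuotOne J φ r) = Ideal.Quotient.mk (K ^ r) 1 := by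
  obtain ⟨u, hu⟩ := exists_powQuot_hom (r := r) J
    (M := (ModuleCat.restrictScalars φ).obj (powQuot K r)) (Ideal.Quotient.mk (K ^ r) 1)
    (fun y hy => by
      change Ideal.Quotient.mk (K ^ r) (φ y * 1) = 0
      rw [mul_one]
      refine Ideal.Quotient.eq_zero_iff_mem.mpr (Ideal.pow_right_mono h r ?_)
      rw [← Ideal.map_pow]
      exact Ideal.mem_map_of_mem φ hy)
  refine ⟨((ModuleCat.extendRestrictScalarsAdj φ).homEquiv _ _).symm u, Eq.trans ?_ hu⟩
  exact ConcreteCategory.congr_hom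
    (((ModuleCat.extendRestrictScalarsAdj φ).homEquiv _ _).apply_symm_apply u) _

lemma extendScalars_powQuot_hom_ext {r : ℕ} {M : ModuleCat.{0} S}
    {f g : (ModuleCat.extendScalars φ).obj (powQuot J r) ⟶ M}
    (h : f (extendPowQuotOne J φ r) = g (extendPowQuotOne J φ r)) : f = g := by
  apply ((ModuleCat.extendRestrictScalarsAdj φ).homEquiv _ _).injective
  apply powQuot_hom_ext
  exact h

lemma extMap_comp {A B C : ModuleCat.{0} R} (f : A ⟶ B) (g : B ⟶ C) (M : ModuleCat.{0} R)
    (x : ((Ext R (ModuleCat.{0} R) n).obj (op C)).obj M) :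
    ((Ext R (ModuleCat.{0} R) n).map (f ≫ g).op).app M x =
      ((Ext R (ModuleCat.{0} R) n).map f.op).app M
        (((Ext R (ModuleCat.{0} R) n).map g.op).app M x) := by
  rw [op_comp, Functor.map_comp]
  rfl

/-- Surjectivity of the canonical map from Ext to local cohomology is preserved by restriction
of scalars along a flat homomorphism `φ` such that `J.map φ` and `K` have the same radical. -/
lemma extToLocalCoh_restrictScalars_surjective (hφ : φ.Flat) (hJ : J.map φ ≤ K) {N : ℕ}
    (hN : K ^ N ≤ J.map φ) (M : ModuleCat.{0} S)
    (hM : Function.Surjective (extToLocalCoh K n M)) :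
    Function.Surjective (extToLocalCoh J n ((ModuleCat.restrictScalars φ).obj M)) := by
  intro x
  obtain ⟨r, ξ, rfl⟩ := exists_powExtToLocalCoh_eq J n _ x
  obtain ⟨e, he⟩ := exists_extEquiv φ hφ M n
  obtain ⟨u, hu⟩ := exists_powQuot_hom_extendScalars (K := K) J φ (r := r) (s := N * r) (by
    rw [pow_mul, Ideal.map_pow]
    exact Ideal.pow_right_mono hN r)
  obtain ⟨w, hw⟩ := exists_extendScalars_hom_powQuot J φ 1 hJ
  obtain ⟨η, hη⟩ : ∃ η : ((Ext S (ModuleCat.{0} S) n).obj (op (powQuot K 1))).obj M,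
      powExtToLocalCoh K n 1 M η = powExtToLocalCoh K n (N * r) M
        (((Ext S (ModuleCat.{0} S) n).map u.op).app M (e _ ξ)) := hM _
  obtain ⟨t, h1, h2, ht⟩ := exists_map_eq_of_powExtToLocalCoh_eq K n M η _ hη
  have htm : t ≤ max t r := le_max_left t r
  have hrm : r ≤ max t r := le_max_right t r
  obtain ⟨v, hv⟩ := exists_extendScalars_hom_powQuot J φ (max t r) hJ
  have hv1 : v ≫ powQuotMap K htm ≫ powQuotMap K h1 =
      (ModuleCat.extendScalars φ).map (powQuotMap J (h1.trans htm)) ≫ w := by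
    apply extendScalars_powQuot_hom_ext
    rw [ConcreteCategory.comp_apply, ConcreteCategory.comp_apply, ConcreteCategory.comp_apply,
      extendScalars_map_extendPowQuotOne, hw, hv]
    rfl
  have hv2 : v ≫ powQuotMap K htm ≫ powQuotMap K h2 ≫ u =
      (ModuleCat.extendScalars φ).map (powQuotMap J hrm) := by
    apply extendScalars_powQuot_hom_ext
    rw [extendScalars_map_extendPowQuotOne, ← hu, ConcreteCategory.comp_apply, hv]
    rfl
  have key : ((Ext R (ModuleCat.{0} R) n).map (powQuotMap J (h1.trans htm)).op).app _
        ((e _).symm (((Ext S (ModuleCat.{0} S) n).map w.op).app M η)) =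
      ((Ext R (ModuleCat.{0} R) n).map (powQuotMap J hrm).op).app _ ξ := by
    apply (e _).injective
    rw [he, he, Equiv.apply_symm_apply, ← extMap_comp, ← hv1, ← hv2, extMap_comp, extMap_comp,
      ht, extMap_comp, extMap_comp, extMap_comp]
  exact ⟨_, (powExtToLocalCoh_map J n (h1.trans htm) _ _).symm.trans
    ((congr_arg _ key).trans (powExtToLocalCoh_map J n hrm _ _))⟩

end LocalCohomology

section Splitting
variable {R S : Type} [CommRing R] [CommRing S] (φ : R →+* S)

/-- A ring homomorphism making the target a direct summand of a free module is flat. -/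
lemma flat_of_split {ι : Type} (P : S →+ (ι →₀ R)) (hP : ∀ a x, P (φ a * x) = a • P x)
    (b : ι → S) (hb : ∀ x, ((P x).sum fun i a => φ a * b i) = x) : φ.Flat := by
  algebraize [φ]
  let P' : S →ₗ[R] (ι →₀ R) :=
    { P with
      map_smul' := fun a x => (congr_arg P (Algebra.smul_def a x)).trans (hP a x) }
  have h := Module.Projective.of_split P' (Finsupp.linearCombination R b) (by
    ext x
    refine Eq.trans ?_ (hb x)
    simp [Finsupp.linearCombination_apply, Algebra.smul_def, P']
    rfl)
  exact inferInstanceAs (Module.Flat R S)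

/-- If `p` is an `R`-linear retraction of `φ : R → S` carrying `I` into `J`, and `φ` carries `J`
into `I`, then `R ⧸ J` is a retract of `S ⧸ I`. -/
lemma exists_retract_quotient (p : S →+ R) (hp : ∀ a x, p (φ a * x) = a * p x) (hp1 : p 1 = 1)
    (J : Ideal R) (I : Ideal S) (hJ : J ≤ I.comap φ) (hI : ∀ x ∈ I, p x ∈ J) :
    ∃ (ι : ModuleCat.of R (R ⧸ J) ⟶ (ModuleCat.restrictScalars φ).obj (ModuleCat.of S (S ⧸ I)))
      (ρ : (ModuleCat.restrictScalars φ).obj (ModuleCat.of S (S ⧸ I)) ⟶ ModuleCat.of R (R ⧸ J)),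
      ι ≫ ρ = 𝟙 _ := by
  let q : S ⧸ I →+ R ⧸ J := QuotientAddGroup.map I.toAddSubgroup J.toAddSubgroup p hI
  refine ⟨ModuleCat.ofHom (X := R ⧸ J)
      (Y := (ModuleCat.restrictScalars φ).obj (ModuleCat.of S (S ⧸ I)))
      { toFun := Ideal.quotientMap I φ hJ
        map_add' := map_add _
        map_smul' := fun a x => ?_ },
    ModuleCat.ofHom (Y := R ⧸ J)
      (X := (ModuleCat.restrictScalars φ).obj (ModuleCat.of S (S ⧸ I)))
      { toFun := q
        map_add' := map_add q
        map_smul' := fun a x => ?_ }, ?_⟩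
  · obtain ⟨x, rfl⟩ := Ideal.Quotient.mk_surjective x
    exact congr_arg (Ideal.Quotient.mk I) (map_mul φ a x)
  · obtain ⟨x, rfl⟩ := Ideal.Quotient.mk_surjective x
    exact congr_arg (Ideal.Quotient.mk J) (hp a x)
  · refine ModuleCat.hom_ext (LinearMap.ext fun x => ?_)
    obtain ⟨x, rfl⟩ := Ideal.Quotient.mk_surjective x
    refine congr_arg (Ideal.Quotient.mk J) ?_
    simpa [hp1] using hp x 1

end Splitting

section Monomial
variable {k σ : Type} [Field k]

/-- The decomposition of a polynomial along the monomials modulo `t`-th powers: the component at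
`r` of the image of `f` has coefficient at `a` equal to the coefficient of `f` at `t • a + r`. -/
def expandDecomp (t : ℕ) : MvPolynomial σ k →ₗ[k] (σ →₀ ℕ) →₀ MvPolynomial σ k :=
  (basisMonomials σ k).constr k fun d =>
    Finsupp.single (d.mapRange (· % t) (Nat.zero_mod t))
      (monomial (d.mapRange (· / t) (Nat.zero_div t)) 1)

lemma expandDecomp_monomial (t : ℕ) (d : σ →₀ ℕ) (c : k) :
    expandDecomp t (monomial d c) = Finsupp.single (d.mapRange (· % t) (Nat.zero_mod t))
      (monomial (d.mapRange (· / t) (Nat.zero_div t)) c) := by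
  have h : (monomial d c : MvPolynomial σ k) = c • basisMonomials σ k d := by
    simp [smul_monomial]
  rw [h, map_smul, expandDecomp, Module.Basis.constr_basis, Finsupp.smul_single, smul_monomial,
    smul_eq_mul, mul_one]

lemma expand_monomial_smul (t : ℕ) (d : σ →₀ ℕ) (c : k) :
    expand t (monomial d c) = monomial (t • d) c := by
  rw [expand_monomial, monomial_eq,
    Finsupp.prod_of_support_subset _ Finsupp.support_smul _ fun i _ => pow_zero _]

lemma expandDecomp_expand_mul {t : ℕ} (ht : 0 < t) (g f : MvPolynomial σ k) :
    expandDecomp t (expand t g * f) = g • expandDecomp t f := by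
  induction g using MvPolynomial.induction_on' with
  | add g h hg hh => rw [map_add, add_mul, map_add, hg, hh, add_smul]
  | monomial a b =>
    induction f using MvPolynomial.induction_on' with
    | add g h hg hh => rw [mul_add, map_add, hg, hh, map_add, smul_add]
    | monomial d c =>
      rw [expand_monomial_smul, monomial_mul, expandDecomp_monomial, expandDecomp_monomial,
        Finsupp.smul_single, smul_eq_mul, monomial_mul]
      have h1 : (t • a + d).mapRange (· % t) (Nat.zero_mod t) =
          d.mapRange (· % t) (Nat.zero_mod t) := by
        ext i
        simp
      have h2 : (t • a + d).mapRange (· / t) (Nat.zero_div t) =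
          a + d.mapRange (· / t) (Nat.zero_div t) := by
        ext i
        simp [Nat.mul_add_div ht]
      rw [h1, h2]

lemma sum_expandDecomp (t : ℕ) (f : MvPolynomial σ k) :
    ((expandDecomp t f).sum fun r g => expand t g * monomial r 1) = f := by
  induction f using MvPolynomial.induction_on' with
  | add g h hg hh =>
    rw [map_add, Finsupp.sum_add_index' (by simp) (by simp [add_mul]), hg, hh]
  | monomial d c =>
    rw [expandDecomp_monomial, Finsupp.sum_single_index (by simp)]
    rw [expand_monomial_smul, monomial_mul, mul_one]
    congr 2
    ext i
    simpa using Nat.div_add_mod (d i) t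

lemma expandDecomp_one (t : ℕ) :
    expandDecomp t (1 : MvPolynomial σ k) = Finsupp.single 0 1 := by
  refine (expandDecomp_monomial t 0 1).trans ?_
  rw [Finsupp.mapRange_zero, Finsupp.mapRange_zero]
  rfl

lemma flat_expand {t : ℕ} (ht : 0 < t) :
    (expand t : MvPolynomial σ k →ₐ[k] MvPolynomial σ k).toRingHom.Flat :=
  flat_of_split _ (expandDecomp t).toAddMonoidHom (expandDecomp_expand_mul ht)
    (fun r => monomial r 1) (sum_expandDecomp t)

lemma IsMonomialIdeal.monomial_mem {I : Ideal (MvPolynomial σ k)} (hI : IsMonomialIdeal I)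
    {f : MvPolynomial σ k} (hf : f ∈ I) {d : σ →₀ ℕ} (hd : d ∈ f.support) (c : k) :
    monomial d c ∈ I := by
  obtain ⟨T, rfl⟩ := hI
  rw [mem_ideal_span_monomial_image] at hf ⊢
  intro e he
  rw [Finset.mem_singleton.mp (support_monomial_subset he)]
  exact hf d hd

lemma mem_of_forall_monomial_mem {I : Ideal (MvPolynomial σ k)}
    {f : MvPolynomial σ k} (hf : ∀ d ∈ f.support, (monomial d 1 : MvPolynomial σ k) ∈ I) :
    f ∈ I := by
  rw [f.as_sum]
  refine Ideal.sum_mem _ fun d hd => ?_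
  rw [← mul_one (coeff d f), ← smul_eq_mul, ← smul_monomial, smul_eq_C_mul]
  exact I.mul_mem_left _ (hf d hd)

/-- The radical of a monomial ideal contains every monomial occurring in its elements. -/
lemma IsMonomialIdeal.monomial_mem_radical {I : Ideal (MvPolynomial σ k)}
    (hI : IsMonomialIdeal I) {f : MvPolynomial σ k} (hf : f ∈ I.radical) {d : σ →₀ ℕ}
    (hd : d ∈ f.support) : (monomial d 1 : MvPolynomial σ k) ∈ I.radical := by
  classical
  by_contra h
  let ψ : MvPolynomial σ k →ₐ[k] MvPolynomial σ k := aeval fun i => if d i = 0 then 0 else X i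
  have hψ (e : σ →₀ ℕ) (c : k) :
      ψ (monomial e c) = if ∀ i, d i = 0 → e i = 0 then monomial e c else 0 := by
    rw [aeval_monomial]
    split_ifs with he
    · rw [monomial_eq]
      refine congr_arg _ (Finset.prod_congr rfl fun i hi => ?_)
      dsimp only
      rw [if_neg fun h0 => Finsupp.mem_support_iff.mp hi (he i h0)]
    · push Not at he
      obtain ⟨i, hi, hei⟩ := he
      rw [Finsupp.prod, Finset.prod_eq_zero (Finsupp.mem_support_iff.mpr hei), mul_zero]
      rw [if_pos hi, zero_pow hei]
  have hψd (g : MvPolynomial σ k) : coeff d (ψ g) = coeff d g := by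
    induction g using MvPolynomial.induction_on' with
    | add p q hp hq => rw [map_add, coeff_add, coeff_add, hp, hq]
    | monomial e c =>
      rw [hψ]
      split_ifs with he
      · rfl
      · rw [coeff_zero, coeff_monomial, if_neg]
        rintro rfl
        exact he fun _ => id
  have hIψ : I ≤ RingHom.ker ψ := by
    obtain ⟨T, rfl⟩ := hI
    rw [Ideal.span_le]
    rintro _ ⟨e, he, rfl⟩
    refine (hψ e 1).trans (if_neg fun hed => h ⟨e.degree, ?_⟩)
    have hle : e ≤ e.degree • d := fun i => by
      by_cases hi : d i = 0
      · simp [hed i hi]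
      · exact (Finsupp.le_degree i e).trans (Nat.le_mul_of_pos_right _ (Nat.pos_of_ne_zero hi))
    have hm : (monomial (e.degree • d) 1 : MvPolynomial σ k) =
        monomial (e.degree • d - e) 1 * monomial e 1 := by
      rw [monomial_mul, mul_one, tsub_add_cancel_of_le hle]
    rw [monomial_pow, one_pow, hm]
    exact Ideal.mul_mem_left _ _ (Ideal.subset_span ⟨e, he, rfl⟩)
  obtain ⟨n, hn⟩ := hf
  have hfψ : ψ f ^ n = 0 := (map_pow ψ f n).symm.trans (hIψ hn)
  refine mem_support_iff.mp hd ?_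
  rw [← hψd, eq_zero_of_pow_eq_zero hfψ, coeff_zero]

lemma exists_map_expand_radical_le [Finite σ] {I : Ideal (MvPolynomial σ k)}
    (hI : IsMonomialIdeal I) :
    ∃ t, 0 < t ∧ I.radical ≤ I.comap (expand t : MvPolynomial σ k →ₐ[k] _).toRingHom := by
  obtain ⟨N, hN⟩ := I.exists_radical_pow_le_of_fg (IsNoetherian.noetherian _)
  refine ⟨N + 1, N.succ_pos, fun f hf => mem_of_forall_monomial_mem fun d hd => ?_⟩
  change expand (N + 1) (monomial d 1) ∈ I
  have h := Ideal.pow_mem_pow (hI.monomial_mem_radical hf hd) (N + 1)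
  rw [monomial_pow, one_pow, ← expand_monomial_smul] at h
  exact hN (Ideal.pow_le_pow_right N.le_succ h)

lemma expandDecomp_apply_mem_radical (t : ℕ) {I : Ideal (MvPolynomial σ k)}
    (hI : IsMonomialIdeal I) {f : MvPolynomial σ k} (hf : f ∈ I) :
    expandDecomp t f 0 ∈ I.radical := by
  classical
  rw [f.as_sum, map_sum, Finsupp.finsetSum_apply]
  refine Ideal.sum_mem _ fun d hd => ?_
  rw [expandDecomp_monomial, Finsupp.single_apply]
  split_ifs with h
  · refine ⟨t, ?_⟩
    have hd' : t • d.mapRange (· / t) (Nat.zero_div t) = d := by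
      ext i
      exact Nat.mul_div_cancel' (Nat.dvd_of_mod_eq_zero (DFunLike.congr_fun h i))
    rw [monomial_pow, hd']
    exact hI.monomial_mem hf hd _
  · exact zero_mem _

lemma map_expand_maxIdeal_le {t : ℕ} (ht : 0 < t) :
    (maxIdeal k σ).map (expand t : MvPolynomial σ k →ₐ[k] _).toRingHom ≤ maxIdeal k σ := by
  rw [maxIdeal, Ideal.map_span, Ideal.span_le]
  rintro _ ⟨_, ⟨i, rfl⟩, rfl⟩
  change expand t (X i) ∈ _
  rw [expand_X]
  exact Ideal.pow_mem_of_mem _ (Ideal.subset_span (Set.mem_range_self i)) t ht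

lemma exists_maxIdeal_pow_le [Finite σ] (t : ℕ) :
    ∃ N, maxIdeal k σ ^ N ≤
      (maxIdeal k σ).map (expand t : MvPolynomial σ k →ₐ[k] _).toRingHom := by
  refine Ideal.exists_pow_le_of_le_radical_of_fg ?_ (IsNoetherian.noetherian _)
  rw [maxIdeal, Ideal.span_le]
  rintro _ ⟨i, rfl⟩
  refine Ideal.mem_radical_iff.mpr ⟨t, ?_⟩
  rw [← expand_X]
  exact Ideal.mem_map_of_mem (expand t : MvPolynomial σ k →ₐ[k] _).toRingHom
    (Ideal.subset_span (Set.mem_range_self i))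


end Monomial

/-- If a monomial ideal `I` is Buchsbaum, then its radical `√I` is
Buchsbaum. -/
theorem stmt_11 (k σ : Type) [Field k] [Fintype σ] (I : Ideal (MvPolynomial σ k))
    (hI : IsMonomialIdeal I)
    (hB : IsBuchsbaumIdeal (maxIdeal k σ) I) :
    IsBuchsbaumIdeal (maxIdeal k σ) I.radical := by
  intro i hi
  obtain ⟨t, ht, hrad⟩ := exists_map_expand_radical_le hI
  obtain ⟨N, hN⟩ := exists_maxIdeal_pow_le (k := k) (σ := σ) t
  obtain ⟨ι, ρ, h⟩ := exists_retract_quotient (expand t : MvPolynomial σ k →ₐ[k] _).toRingHom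
    ((Finsupp.applyAddHom 0).comp (expandDecomp t).toAddMonoidHom)
    (fun g f => DFunLike.congr_fun (expandDecomp_expand_mul ht g f) 0)
    ((DFunLike.congr_fun (expandDecomp_one t) 0).trans (Finsupp.single_eq_same))
    I.radical I hrad fun f hf => expandDecomp_apply_mem_radical t hI hf
  refine extToLocalCoh_surjective_of_retract _ i ι ρ h
    (extToLocalCoh_restrictScalars_surjective _ i _ (flat_expand ht)
      (map_expand_maxIdeal_le ht) hN _ (hB i (hi.trans_le ?_)))
  exact ringKrullDim_le_of_surjective (Ideal.Quotient.factor I.le_radical)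
    (Ideal.Quotient.factor_surjective I.le_radical)

end SkewTab
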